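/- For every positive integer k there exist constants C = C_k ≥ 1 and D = D_k ≥ 1 such that the following holds. Suppose α : G^k → 𝔽₂ is a multilinear form which is symmetric in its first two variables and has partition rank at most r. Let α^{×2} : G^{k−1} → 𝔽₂ be the multilinear form defined by α^{×2}(d, x₃, …, x_k) = α(d, d, x₃, …, x_k). Then α^{×2} has partition rank at most C·r^D. -/

import Mathlib

open Finset

/-- `β : (Fin k → V) → ZMod 2` is a multilinear form in the variables indexed by `S`:
it depends only on the coordinates in `S` and is additive (hence `𝔽₂`-linear) in each of
those coordinates. -/
def MultilinearOn {V : Type*} [AddCommGroup V] [Module (ZMod 2) V] (k : ℕ)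
    (S : Finset (Fin k)) (β : (Fin k → V) → ZMod 2) : Prop :=
  (∀ x y : Fin k → V, (∀ i ∈ S, x i = y i) → β x = β y) ∧
  (∀ i ∈ S, ∀ (x : Fin k → V) (u v : V),
    β (Function.update x i (u + v)) = β (Function.update x i u) + β (Function.update x i v))

/-- A multilinear form in all `k` variables. -/
def IsMultilinear {V : Type*} [AddCommGroup V] [Module (ZMod 2) V] (k : ℕ)
    (α : (Fin k → V) → ZMod 2) : Prop :=
  MultilinearOn k Finset.univ α

/-- `α`, a multilinear form in the variables indexed by `S`, admits a partition-rank
decomposition with `m` terms. -/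
def PrankDecompOn {V : Type*} [AddCommGroup V] [Module (ZMod 2) V] (k : ℕ)
    (S : Finset (Fin k)) (m : ℕ) (α : (Fin k → V) → ZMod 2) : Prop :=
  ∃ (I : Fin m → Finset (Fin k)) (β γ : Fin m → ((Fin k → V) → ZMod 2)),
    (∀ i, I i ⊆ S) ∧ (∀ i, I i ≠ ∅) ∧ (∀ i, I i ≠ S) ∧
    (∀ i, MultilinearOn k (I i) (β i)) ∧
    (∀ i, MultilinearOn k (S \ I i) (γ i)) ∧
    (∀ x, α x = ∑ i, β i x * γ i x)

/-- The partition rank of a multilinear form in the variables indexed by `S`. -/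
noncomputable def prankOn {V : Type*} [AddCommGroup V] [Module (ZMod 2) V] (k : ℕ)
    (S : Finset (Fin k)) (α : (Fin k → V) → ZMod 2) : ℕ :=
  sInf {m | PrankDecompOn k S m α}

/-- The partition rank of a multilinear form in `k` variables. -/
noncomputable def prank {V : Type*} [AddCommGroup V] [Module (ZMod 2) V] (k : ℕ)
    (α : (Fin k → V) → ZMod 2) : ℕ :=
  prankOn k Finset.univ α

/-- `α ∘ π`: the form `(x₁, …, x_k) ↦ α(x_{π⁻¹(1)}, …, x_{π⁻¹(k)})`. -/
def permForm {V : Type*} (k : ℕ) (π : Equiv.Perm (Fin k))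
    (α : (Fin k → V) → ZMod 2) : (Fin k → V) → ZMod 2 :=
  fun x => α (fun i => x (π.symm i))

/-- `α` is symmetric in its first `m` variables (0-indexed: coordinates `< m`). -/
def SymmetricInFirst {V : Type*} (k m : ℕ) (α : (Fin k → V) → ZMod 2) : Prop :=
  ∀ i j : Fin k, (i : ℕ) < m → (j : ℕ) < m → permForm k (Equiv.swap i j) α = α

/-- `α` is symmetric in all of its variables. -/
def SymmetricForm {V : Type*} (k : ℕ) (α : (Fin k → V) → ZMod 2) : Prop :=
  ∀ π : Equiv.Perm (Fin k), permForm k π α = α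

/-- `σ` is strongly symmetric: it is symmetric, and the form
`(x, y₃, …, y_k) ↦ σ(x, x, y₃, …, y_k)` is also symmetric.  (Given the symmetry of `σ`,
the latter is equivalent to being allowed to swap the doubled variable with the third
variable, which is how it is stated here.) -/
def StronglySymmetric {V : Type*} (k : ℕ) (σ : (Fin k → V) → ZMod 2) : Prop :=
  SymmetricForm k σ ∧
  ∀ (u v : V) (z : Fin k → V),
    σ (fun i => if (i : ℕ) = 0 ∨ (i : ℕ) = 1 then u else if (i : ℕ) = 2 then v else z i) =
    σ (fun i => if (i : ℕ) = 0 ∨ (i : ℕ) = 1 then v else if (i : ℕ) = 2 then u else z i)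

/-- `F` is a sum of at most `m` elements satisfying `P`. -/
inductive SumOf {M : Type*} [AddCommMonoid M] (P : M → Prop) : ℕ → M → Prop
  | zero (m : ℕ) : SumOf P m 0
  | add {m : ℕ} {t F : M} : P t → SumOf P m F → SumOf P (m + 1) (t + F)

namespace SumOf

section AddCommMonoid

variable {M N : Type*} [AddCommMonoid M] [AddCommMonoid N] {P Q R : M → Prop} {m m' : ℕ} {F G : M}

theorem mono (h : SumOf P m F) : ∀ {m'}, m ≤ m' → SumOf P m' F := by
  induction h with
  | zero m => exact fun _ => zero _
  | add ht _ ih =>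
    intro m' hm
    obtain ⟨n, rfl⟩ : ∃ n, m' = n + 1 := ⟨m' - 1, by omega⟩
    exact add ht (ih (by omega))

theorem single {t : M} (ht : P t) : SumOf P 1 t := by
  simpa using add ht (zero (P := P) 0)

theorem append (h : SumOf P m F) (h' : SumOf P m' G) : SumOf P (m + m') (F + G) := by
  induction h with
  | zero m => simpa using h'.mono (by omega)
  | @add m t F ht _ ih =>
    rw [add_assoc t]
    exact (add ht ih).mono (by omega)

/-- A property containing `0`, closed under addition and implied by `P` holds for all sums. -/
theorem induction_closed (h : SumOf P m F) (h0 : Q 0) (hadd : ∀ a b, Q a → Q b → Q (a + b))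
    (hPQ : ∀ t, P t → Q t) : Q F := by
  induction h with
  | zero m => exact h0
  | add ht _ ih => exact hadd _ _ (hPQ _ ht) ih

theorem split (h : SumOf P m F) {m₁ m₂ : ℕ}
    (hs : ∀ t, P t → ∃ g u, t = g + u ∧ SumOf Q m₁ g ∧ SumOf R m₂ u) :
    ∃ G U, F = G + U ∧ SumOf Q (m * m₁) G ∧ SumOf R (m * m₂) U := by
  induction h with
  | zero m => exact ⟨0, 0, by simp, zero _, zero _⟩
  | @add m t F ht _ ih =>
    obtain ⟨G, U, rfl, hG, hU⟩ := ih
    obtain ⟨g, u, rfl, hg, hu⟩ := hs _ ht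
    refine ⟨g + G, u + U, by abel, ?_, ?_⟩
    · exact (hg.append hG).mono (by rw [add_mul]; omega)
    · exact (hu.append hU).mono (by rw [add_mul]; omega)

theorem bind (h : SumOf P m F) (f : M →+ N) {Q : N → Prop}
    (hs : ∀ t, P t → SumOf Q m' (f t)) : SumOf Q (m * m') (f F) := by
  induction h with
  | zero m => simpa using zero _
  | @add m t F ht _ ih =>
    rw [map_add]
    exact ((hs _ ht).append ih).mono (by rw [add_mul]; omega)

theorem map (h : SumOf P m F) (f : M →+ N) {Q : N → Prop}
    (hs : ∀ t, P t → Q (f t)) : SumOf Q m (f F) := by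
  simpa using h.bind f fun t ht => single (hs t ht)

theorem imp (h : SumOf P m F) (hs : ∀ t, P t → Q t) : SumOf Q m F :=
  h.map (AddMonoidHom.id M) hs

theorem sum {n : ℕ} {t : Fin n → M} (h : ∀ i, SumOf P m (t i)) :
    SumOf P (n * m) (∑ i, t i) := by
  induction n with
  | zero => simpa using zero _
  | succ n ih =>
    rw [Fin.sum_univ_succ]
    exact ((h 0).append (ih fun i => h i.succ)).mono (by rw [add_mul]; omega)

theorem exists_sum (h : SumOf P m F) :
    ∃ m' ≤ m, ∃ t : Fin m' → M, (∀ i, P (t i)) ∧ F = ∑ i, t i := by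
  induction h with
  | zero m => exact ⟨0, by omega, Fin.elim0, fun i => i.elim0, by simp⟩
  | @add m s F hs _ ih =>
    obtain ⟨m', hm, t, ht, rfl⟩ := ih
    refine ⟨m' + 1, by omega, Fin.cons s t, fun i => ?_, by simp [Fin.sum_univ_succ]⟩
    induction i using Fin.cases with
    | zero => simpa using hs
    | succ i => simpa using ht i

end AddCommMonoid

theorem mul {A : Type*} [CommRing A] {P Q R : A → Prop} {m m' : ℕ} {F G : A}
    (h : SumOf P m F) (h' : SumOf Q m' G) (hR : ∀ t u, P t → Q u → R (t * u)) :
    SumOf R (m * m') (F * G) :=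
  h.bind (AddMonoidHom.mulRight G) fun t ht => h'.map (AddMonoidHom.mulLeft t) fun u hu =>
    hR t u ht hu

end SumOf

/-- Finitely many functions are recovered from their values at as many points. -/
theorem exists_interpolation_points {K Y : Type*} [Field K] {m : ℕ} (c : Fin m → Y → K) :
    ∃ m' ≤ m, ∃ (p : Fin m' → Y) (e : Fin m' → Fin m → K),
      ∀ j y, c j y = ∑ i, c j (p i) * ∑ l, e i l * c l y := by
  classical
  let v : Y → Fin m → K := fun y j => c j y
  obtain ⟨κ, a, -, hspan, hli⟩ := exists_linearIndependent' K v
  have : Finite κ := hli.finite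
  have : Fintype κ := Fintype.ofFinite κ
  have hcard : Fintype.card κ ≤ m := by simpa using hli.fintype_card_le_finrank
  obtain ⟨g, hg⟩ := LinearMap.exists_leftInverse_of_injective
    (Finsupp.linearCombination K (v ∘ a)) (LinearMap.ker_eq_bot.2 hli)
  let eq := Fintype.equivFin κ
  refine ⟨Fintype.card κ, hcard, fun i => a (eq.symm i),
    fun i l => g (Pi.single l 1) (eq.symm i), fun j y => ?_⟩
  have hy : v y ∈ Submodule.span K (Set.range (v ∘ a)) := by
    rw [hspan]; exact Submodule.subset_span ⟨y, rfl⟩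
  obtain ⟨w, hw⟩ := (Finsupp.mem_span_range_iff_exists_finsupp).1 hy
  have hw' : Finsupp.linearCombination K (v ∘ a) w = v y := hw
  have hgw : g (v y) = w := by
    rw [← hw']; exact LinearMap.congr_fun hg w
  have hcoord : ∀ i, ∑ l, g (Pi.single l 1) i * c l y = w i := by
    intro i
    rw [← hgw]
    conv_rhs => rw [show v y = ∑ l, c l y • (Pi.single l (1 : K) : Fin m → K) by
      simpa using pi_eq_sum_univ' (v y)]
    simp [Finsupp.finsetSum_apply, mul_comm]
  rw [Finsupp.linearCombination_apply, Finsupp.sum_fintype _ _ (by simp)] at hw'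
  calc c j y = ∑ i, c j (a i) * w i := by
        simpa [v, mul_comm] using (congrFun hw' j).symm
    _ = ∑ i, c j (a (eq.symm i)) * w (eq.symm i) :=
        (Equiv.sum_comp eq.symm fun i => c j (a i) * w i).symm
    _ = _ := by simp only [hcoord]

namespace MultilinearOn

variable {V : Type*} [AddCommGroup V] [Module (ZMod 2) V] {k : ℕ} {S T : Finset (Fin k)}
  {f g : (Fin k → V) → ZMod 2}

theorem zero : MultilinearOn k S (0 : (Fin k → V) → ZMod 2) :=
  ⟨fun _ _ _ => rfl, fun _ _ _ _ _ => by simp⟩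

theorem one : MultilinearOn k ∅ (1 : (Fin k → V) → ZMod 2) :=
  ⟨fun _ _ _ => rfl, fun i hi => by simp at hi⟩

theorem add (hf : MultilinearOn k S f) (hg : MultilinearOn k S g) : MultilinearOn k S (f + g) :=
  ⟨fun x y h => by simp [hf.1 x y h, hg.1 x y h], fun i hi x u v => by
    simp only [Pi.add_apply, hf.2 i hi, hg.2 i hi]; ring⟩

theorem update_of_notMem (hf : MultilinearOn k S f) {i : Fin k} (hi : i ∉ S) (x : Fin k → V)
    (u : V) : f (Function.update x i u) = f x :=
  hf.1 _ _ fun j hj => Function.update_of_ne (by rintro rfl; exact hi hj) _ _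

theorem mul (hf : MultilinearOn k S f) (hg : MultilinearOn k T g) (h : Disjoint S T) :
    MultilinearOn k (S ∪ T) (f * g) := by
  refine ⟨fun x y hxy => ?_, fun i hi x u v => ?_⟩
  · simp [hf.1 x y fun i hi => hxy i (mem_union_left _ hi),
      hg.1 x y fun i hi => hxy i (mem_union_right _ hi)]
  · simp only [Pi.mul_apply]
    rcases mem_union.1 hi with hi | hi
    · simp only [hf.2 i hi, hg.update_of_notMem (disjoint_left.1 h hi)]; ring
    · simp only [hg.2 i hi, hf.update_of_notMem (disjoint_right.1 h hi)]; ring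

theorem piecewise (hf : MultilinearOn k S f) (U : Finset (Fin k)) (p : Fin k → V) :
    MultilinearOn k (S ∩ U) fun z => f (U.piecewise z p) := by
  refine ⟨fun x y hxy => hf.1 _ _ fun i hi => ?_, fun i hi x u v => ?_⟩
  · by_cases hU : i ∈ U
    · simp [hU, hxy i (mem_inter.2 ⟨hi, hU⟩)]
    · simp [hU]
  · obtain ⟨hS, hU⟩ := mem_inter.1 hi
    have : ∀ w, U.piecewise (Function.update x i w) p =
        Function.update (U.piecewise x p) i w := fun w => by
      funext m
      by_cases hm : m = i
      · subst hm; simp [hU]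
      · simp [Finset.piecewise, hm]
    simp only [this, hf.2 i hS]

theorem comp {l : ℕ} (ψ : Fin k → Fin l) (hψ : Set.InjOn ψ S) (hf : MultilinearOn k S f) :
    MultilinearOn l (S.image ψ) fun y : Fin l → V => f fun i => y (ψ i) := by
  refine ⟨fun x y hxy => hf.1 _ _ fun i hi => hxy _ (mem_image_of_mem ψ hi),
    fun j hj x u v => ?_⟩
  obtain ⟨i, hi, rfl⟩ := mem_image.1 hj
  have : ∀ w, f (fun m => Function.update x (ψ i) w (ψ m)) =
      f (Function.update (fun m => x (ψ m)) i w) := fun w => by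
    refine hf.1 _ _ fun m hm => ?_
    by_cases hmi : m = i
    · simp [hmi]
    · have : ψ m ≠ ψ i := fun h => hmi (hψ hm hi h)
      simp [hmi, this]
  simp only [this, hf.2 i hi]

theorem swap (hf : MultilinearOn k S f) (i j : Fin k) :
    MultilinearOn k (S.image (Equiv.swap i j)) (permForm k (Equiv.swap i j) f) :=
  hf.comp (Equiv.swap i j) (Equiv.swap i j).injective.injOn

end MultilinearOn

/-- Precomposition with a self-map of the domain, as an additive homomorphism. -/
def precomp {X : Type*} (φ : X → X) : (X → ZMod 2) →+ (X → ZMod 2) where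
  toFun F := F ∘ φ
  map_zero' := rfl
  map_add' _ _ := rfl

/-- Interchange of the variables `i` and `j`. -/
abbrev swapHom {V : Type*} {k : ℕ} (i j : Fin k) :
    ((Fin k → V) → ZMod 2) →+ ((Fin k → V) → ZMod 2) :=
  precomp fun z => z ∘ Equiv.swap i j

/-- Substitution of the variable `i` for the variable `j`. -/
abbrev diagHom {V : Type*} {k : ℕ} (i j : Fin k) :
    ((Fin k → V) → ZMod 2) →+ ((Fin k → V) → ZMod 2) :=
  precomp fun z => Function.update z j (z i)

/-- Specialization of the variables outside `I` to `p`. -/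
abbrev restrictHom {V : Type*} {k : ℕ} (I : Finset (Fin k)) (p : Fin k → V) :
    ((Fin k → V) → ZMod 2) →+ ((Fin k → V) → ZMod 2) :=
  precomp fun z => I.piecewise z p

section Forms

variable {V : Type*} {k : ℕ} {i j : Fin k} {f : (Fin k → V) → ZMod 2}

theorem swapHom_swapHom (f : (Fin k → V) → ZMod 2) : swapHom i j (swapHom i j f) = f := by
  funext z
  simp [precomp, Function.comp_assoc, ← Equiv.coe_trans]

theorem diagHom_swapHom (hij : i ≠ j) (f : (Fin k → V) → ZMod 2) :
    diagHom i j (swapHom i j f) = diagHom i j f := by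
  funext z
  refine congrArg f (funext fun m => ?_)
  by_cases hi : m = i
  · simp [hi, hij]
  by_cases hj : m = j
  · simp [hj, hij]
  simp [Equiv.swap_apply_of_ne_of_ne hi hj]

theorem swapHom_restrictHom {I : Finset (Fin k)} (hi : i ∈ I) (hj : j ∈ I) (p : Fin k → V)
    (hf : swapHom i j f = f) : swapHom i j (restrictHom I p f) = restrictHom I p f := by
  funext z
  conv_rhs => rw [← hf]
  refine congrArg f (funext fun m => ?_)
  by_cases hmi : m = i
  · simp [hmi, hi, hj]
  by_cases hmj : m = j
  · simp [hmj, hi, hj]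
  simp [Finset.piecewise, Equiv.swap_apply_of_ne_of_ne hmi hmj]

theorem add_self_form (f : (Fin k → V) → ZMod 2) : f + f = 0 :=
  funext fun _ => CharTwo.add_self_eq_zero _

variable [AddCommGroup V] [Module (ZMod 2) V] {S : Finset (Fin k)}

theorem MultilinearOn.diag_of_notMem (hf : MultilinearOn k S f) (hj : j ∉ S) :
    diagHom i j f = f :=
  funext fun z => hf.update_of_notMem hj z _

theorem MultilinearOn.diag (hf : MultilinearOn k S f) (hi : i ∈ S) (hj : j ∈ S) (hij : i ≠ j)
    (hsymm : swapHom i j f = f) : MultilinearOn k (S.erase j) (diagHom i j f) := by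
  refine ⟨fun x y hxy => hf.1 _ _ fun m hm => ?_, fun m hm x u v => ?_⟩
  · by_cases hmj : m = j
    · simp [hmj, hxy i (mem_erase.2 ⟨hij, hi⟩)]
    · simp [hmj, hxy m (mem_erase.2 ⟨hmj, hm⟩)]
  · obtain ⟨hmj, hm⟩ := mem_erase.1 hm
    simp only [precomp, AddMonoidHom.coe_mk, ZeroHom.coe_mk, Function.comp_apply]
    by_cases hmi : m = i
    · subst hmi
      have hcross : f (Function.update (Function.update x m u) j v) =
          f (Function.update (Function.update x m v) j u) := by
        conv_lhs => rw [← hsymm]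
        refine congrArg f (funext fun l => ?_)
        by_cases hlm : l = m
        · simp [hlm, hij]
        by_cases hlj : l = j
        · simp [hlj, hij]
        simp [Equiv.swap_apply_of_ne_of_ne hlm hlj, hlm, hlj]
      simp only [Function.update_self, hf.2 j hj]
      simp only [Function.update_comm hmj _ _ x] at hcross ⊢
      simp only [hf.2 m hm]
      linear_combination hcross +
        CharTwo.add_self_eq_zero (f (Function.update (Function.update x j u) m v))
    · simp only [Function.update_of_ne (Ne.symm hmi), Function.update_comm hmj _ _ x, hf.2 m hm]

end Forms

section Decomposition

variable {V : Type*} {k : ℕ} {i j : Fin k}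

theorem SumOf.contract {m : ℕ} {F : (Fin k → V) → ZMod 2} {I : Finset (Fin k)}
    {Γ : ((Fin k → V) → ZMod 2) → Prop}
    (hΓ : ∀ c, Γ c → ∀ x y : Fin k → V, (∀ l ∉ I, x l = y l) → c x = c y)
    (hF : SumOf (fun t => ∃ b c, (∀ x y : Fin k → V, (∀ l ∈ I, x l = y l) → b x = b y) ∧ Γ c ∧
      t = b * c) m F) :
    SumOf (fun t => ∃ p c, SumOf Γ m c ∧ t = restrictHom I p F * c) m F := by
  obtain ⟨n, hn, t, ht, rfl⟩ := hF.exists_sum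
  choose b c hb hc hbc using ht
  obtain ⟨m', hm', p, e, hpe⟩ := exists_interpolation_points c
  have key : ∑ i, t i = ∑ i, restrictHom I (p i) (∑ i, t i) * ∑ l, e i l • c l := by
    funext z
    simp only [hbc, Finset.sum_apply, Pi.mul_apply, precomp, AddMonoidHom.coe_mk, ZeroHom.coe_mk,
      Function.comp_apply, Pi.smul_apply, smul_eq_mul]
    have h1 : ∀ s i, b i (I.piecewise z (p s)) = b i z := fun s i =>
      hb i _ _ fun l hl => by simp [hl]
    have h2 : ∀ s i, c i (I.piecewise z (p s)) = c i (p s) := fun s i =>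
      hΓ _ (hc i) _ _ fun l hl => by simp [hl]
    simp only [h1, h2, Finset.sum_mul]
    rw [Finset.sum_comm]
    refine Finset.sum_congr rfl fun i _ => ?_
    simp only [mul_assoc, ← Finset.mul_sum]
    rw [← hpe]
  conv_rhs => rw [key]
  refine SumOf.mono (SumOf.sum (m := 1) fun s => SumOf.single ⟨p s, _, ?_, rfl⟩) (by omega)
  refine SumOf.mono (SumOf.sum (m := 1) fun l => ?_) (m' := m) (by omega)
  rcases (by decide : ∀ x : ZMod 2, x = 0 ∨ x = 1) (e s l) with h | h
  · rw [h, zero_smul]; exact .zero _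
  · rw [h, one_smul]; exact .single (hc l)

variable [AddCommGroup V] [Module (ZMod 2) V]

/-- A product of forms on `A`, `B` and the remaining variables, with `i ∈ A ∈ 𝓐` and
`j ∈ B ∈ swap i j • 𝓑`. -/
def IsSplitTerm (i j : Fin k) (𝓐 𝓑 : Finset (Finset (Fin k))) (t : (Fin k → V) → ZMod 2) : Prop :=
  ∃ (A B : Finset (Fin k)) (a b c : (Fin k → V) → ZMod 2), i ∈ A ∧ j ∈ B ∧ Disjoint A B ∧ A ∈ 𝓐 ∧
    B.image (Equiv.swap i j) ∈ 𝓑 ∧ MultilinearOn k A a ∧ MultilinearOn k B b ∧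
    MultilinearOn k (A ∪ B)ᶜ c ∧ t = a * b * c

/-- A product of a form on variables including `i` and `j` and a form on the remaining
variables, which constitute a nonempty set in `𝓙`. -/
def IsJointTerm (i j : Fin k) (𝓙 : Finset (Finset (Fin k))) (t : (Fin k → V) → ZMod 2) : Prop :=
  ∃ (J : Finset (Fin k)) (q c : (Fin k → V) → ZMod 2), i ∉ J ∧ j ∉ J ∧ J.Nonempty ∧ J ∈ 𝓙 ∧
    MultilinearOn k Jᶜ q ∧ MultilinearOn k J c ∧ t = q * c

/-- A product of two forms on complementary nonempty subsets of the variables other than `j`. -/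
def IsDiagTerm (j : Fin k) (t : (Fin k → V) → ZMod 2) : Prop :=
  ∃ (I : Finset (Fin k)) (β γ : (Fin k → V) → ZMod 2), I ⊆ univ.erase j ∧ I ≠ ∅ ∧
    I ≠ univ.erase j ∧ MultilinearOn k I β ∧ MultilinearOn k (univ.erase j \ I) γ ∧ t = β * γ

theorem isDiagTerm_diagHom {J : Finset (Fin k)} {s c : (Fin k → V) → ZMod 2} (hij : i ≠ j)
    (hi : i ∉ J) (hj : j ∉ J) (hJ : J.Nonempty) (hs : MultilinearOn k Jᶜ s)
    (hsymm : swapHom i j s = s) (hc : MultilinearOn k J c) :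
    IsDiagTerm j (diagHom i j (s * c)) := by
  refine ⟨J, c, diagHom i j s, fun x hx => mem_erase.2 ⟨?_, mem_univ _⟩, hJ.ne_empty, ?_, hc, ?_,
    ?_⟩
  · rintro rfl; exact hj hx
  · rintro rfl; exact hi (mem_erase.2 ⟨hij, mem_univ _⟩)
  · have := hs.diag (mem_compl.2 hi) (mem_compl.2 hj) hij hsymm
    convert this using 1
    ext x; simp
  · conv_rhs => rw [← hc.diag_of_notMem (i := i) hj]
    rw [mul_comm]; rfl

namespace IsSplitTerm

variable {𝓐 𝓑 𝓐' 𝓑' : Finset (Finset (Fin k))} {t : (Fin k → V) → ZMod 2}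

theorem mono (h : IsSplitTerm i j 𝓐 𝓑 t) (hA : 𝓐 ⊆ 𝓐') (hB : 𝓑 ⊆ 𝓑') :
    IsSplitTerm i j 𝓐' 𝓑' t := by
  obtain ⟨A, B, a, b, c, hi, hj, hAB, hA', hB', h⟩ := h
  exact ⟨A, B, a, b, c, hi, hj, hAB, hA hA', hB hB', h⟩

theorem swap (h : IsSplitTerm i j 𝓐 𝓑 t) : IsSplitTerm i j 𝓑 𝓐 (swapHom i j t) := by
  obtain ⟨A, B, a, b, c, hi, hj, hAB, hA, hB, ha, hb, hc, rfl⟩ := h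
  refine ⟨B.image (Equiv.swap i j), A.image (Equiv.swap i j), swapHom i j b, swapHom i j a,
    swapHom i j c, ?_, ?_, ?_, hB, ?_, hb.swap i j, ha.swap i j, ?_, ?_⟩
  · exact mem_image.2 ⟨j, hj, by simp⟩
  · exact mem_image.2 ⟨i, hi, by simp⟩
  · exact ((disjoint_image (Equiv.swap i j).injective).2 hAB).symm
  · simpa [image_image, ← Equiv.coe_trans] using hA
  · have := hc.swap i j
    rwa [compl_eq_univ_sdiff, image_sdiff _ _ (Equiv.swap i j).injective, image_univ_equiv,
      image_union, union_comm, ← compl_eq_univ_sdiff] at this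
  · funext z
    simp only [precomp, AddMonoidHom.coe_mk, ZeroHom.coe_mk, Function.comp_apply, Pi.mul_apply]
    ring

theorem multilinear (h : IsSplitTerm i j 𝓐 𝓑 t) : MultilinearOn k univ t := by
  obtain ⟨A, B, a, b, c, -, -, hAB, -, -, ha, hb, hc, rfl⟩ := h
  have := (ha.mul hb hAB).mul hc disjoint_compl_right
  rwa [union_compl] at this

/-- Specialization to the variables in a maximal member `I` of a lower set `𝓐`. -/
theorem restrict {I : Finset (Fin k)} (hI : Maximal (· ∈ 𝓐) I) (hi : i ∈ I)
    (hlow : ∀ S ∈ 𝓐, ∀ T ⊆ S, i ∈ T → T ∈ 𝓐) (h : IsSplitTerm i j (𝓐.erase I) 𝓑 t)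
    (p : Fin k → V) :
    ∃ (A : Finset (Fin k)) (a c : (Fin k → V) → ZMod 2), i ∈ A ∧ A ⊆ I ∧ A ∈ 𝓐.erase I ∧
      MultilinearOn k A a ∧ MultilinearOn k (I \ A) c ∧ restrictHom I p t = a * c := by
  obtain ⟨A, B, a, b, c, hiA, hj, hAB, hA, hB, ha, hb, hc, rfl⟩ := h
  obtain ⟨hAI, hA⟩ := mem_erase.1 hA
  refine ⟨A ∩ I, restrictHom I p a, restrictHom I p (b * c), mem_inter.2 ⟨hiA, hi⟩,
    inter_subset_right, mem_erase.2 ⟨fun h => hAI ?_, ?_⟩, ha.piecewise I p, ?_, ?_⟩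
  · exact (hI.eq_of_le hA (inter_eq_right.1 h)).symm
  · exact hlow A hA _ inter_subset_left (mem_inter.2 ⟨hiA, hi⟩)
  · have hd : Disjoint B (A ∪ B)ᶜ := disjoint_compl_right.mono_left subset_union_right
    have hset : I \ (A ∩ I) = (B ∪ (A ∪ B)ᶜ) ∩ I := by
      ext x
      have := fun h : x ∈ A => disjoint_left.1 hAB h
      simp; tauto
    rw [hset]
    exact (hb.mul hc hd).piecewise I p
  · funext z; simp [precomp]; ring

end IsSplitTerm

/-- The step of the elimination of split terms: the maximal block `I` is removed. -/
theorem exists_eliminate_block (hij : i ≠ j) {𝓐 : Finset (Finset (Fin k))} {I : Finset (Fin k)}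
    (hI : Maximal (· ∈ 𝓐) I) (hi : i ∈ I) (hIi : I ≠ {i})
    (hlow : ∀ S ∈ 𝓐, ∀ T ⊆ S, i ∈ T → T ∈ 𝓐) {m : ℕ} {α : (Fin k → V) → ZMod 2}
    (hα : SumOf (IsSplitTerm i j 𝓐 𝓐) m α) (hsymm : swapHom i j α = α) :
    ∃ α', swapHom i j α' = α' ∧ diagHom i j α' = diagHom i j α ∧
      SumOf (IsSplitTerm i j (𝓐.erase I) (𝓐.erase I)) (16 * m ^ 3 + m) α' := by
  set 𝓔 := 𝓐.erase I with h𝓔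
  have hE : 𝓔 ⊆ 𝓐 := erase_subset _ _
  obtain ⟨F₁, F', rfl, hF₁, hF'⟩ := hα.split (m₁ := 1) (m₂ := 1)
      (Q := IsSplitTerm i j {I} 𝓔) (R := IsSplitTerm i j 𝓔 𝓐) fun t ht => by
    obtain ⟨A, B, a, b, c, hiA, hjB, hAB, hA, hB, h⟩ := ht
    by_cases hAI : A = I
    · refine ⟨t, 0, by simp, .single ⟨A, B, a, b, c, hiA, hjB, hAB, by simp [hAI],
        mem_erase.2 ⟨?_, hB⟩, h⟩, .zero _⟩
      intro hBI
      refine hIi (eq_singleton_iff_unique_mem.2 ⟨hi, fun x hx => ?_⟩)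
      by_contra hxi
      obtain ⟨y, hy, hyx⟩ := mem_image.1 (hBI ▸ hx)
      have hxA : x ∈ A := hAI ▸ hx
      have hxj : x ≠ j := by rintro rfl; exact disjoint_left.1 hAB hxA hjB
      have : y = x := by
        rw [← Equiv.swap_apply_self i j y, hyx, Equiv.swap_apply_of_ne_of_ne hxi hxj]
      exact disjoint_left.1 hAB hxA (this ▸ hy)
    · exact ⟨0, t, by simp, .zero _, .single ⟨A, B, a, b, c, hiA, hjB, hAB,
        mem_erase.2 ⟨hAI, hA⟩, hB, h⟩⟩
  obtain ⟨F₂, F₃, rfl, hF₂, hF₃⟩ := hF'.split (m₁ := 1) (m₂ := 1)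
      (Q := IsSplitTerm i j 𝓔 {I}) (R := IsSplitTerm i j 𝓔 𝓔) fun t ht => by
    obtain ⟨A, B, a, b, c, hiA, hjB, hAB, hA, hB, h⟩ := ht
    by_cases hBI : B.image (Equiv.swap i j) = I
    · exact ⟨t, 0, by simp, .single ⟨A, B, a, b, c, hiA, hjB, hAB, hA, by simp [hBI], h⟩, .zero _⟩
    · exact ⟨0, t, by simp, .zero _, .single ⟨A, B, a, b, c, hiA, hjB, hAB, hA,
        mem_erase.2 ⟨hBI, hB⟩, h⟩⟩
  rw [mul_one] at hF₁ hF₂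
  rw [mul_one, mul_one] at hF₃
  simp only [map_add] at hsymm
  refine ⟨F₁ + swapHom i j F₂ + F₃, ?_, ?_, ?_⟩
  · simp only [map_add, swapHom_swapHom]
    linear_combination hsymm + add_self_form F₂ - add_self_form (swapHom i j F₂)
  · simp only [map_add, diagHom_swapHom hij, add_assoc]
  set P := F₁ + swapHom i j F₂ with hP_def
  have hP : SumOf (IsSplitTerm i j {I} 𝓔) (2 * m) P :=
    (hF₁.append (hF₂.map _ fun t ht => ht.swap)).mono (by omega)
  have hU : SumOf (IsSplitTerm i j 𝓔 𝓐) (4 * m) (swapHom i j P + F₃ + swapHom i j F₃) := by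
    refine (((hP.map _ fun t ht => ht.swap.mono subset_rfl ?_).append
      (hF₃.imp fun t ht => ht.mono subset_rfl hE)).append
      (hF₃.map _ fun t ht => ht.swap.mono subset_rfl hE)).mono (by omega)
    simpa using hI.prop
  have hPU : P = swapHom i j P + F₃ + swapHom i j F₃ := by
    simp only [hP_def, map_add, swapHom_swapHom]
    linear_combination hsymm + add_self_form F₁ - add_self_form (swapHom i j F₁) -
      add_self_form (swapHom i j F₃)
  have hcontr := SumOf.contract (I := I) (m := 2 * m) (F := P)
    (Γ := fun t => ∃ B b c, j ∈ B ∧ Disjoint B I ∧ B.image (Equiv.swap i j) ∈ 𝓔 ∧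
      MultilinearOn k B b ∧ MultilinearOn k (I ∪ B)ᶜ c ∧ t = b * c) ?_ ?_
  · have hnew := hcontr.bind (AddMonoidHom.id _) (Q := IsSplitTerm i j 𝓔 𝓔)
      (m' := 4 * m * (2 * m)) ?_
    · exact (hnew.append hF₃).mono (by ring_nf; omega)
    rintro _ ⟨p, d, hd, rfl⟩
    rw [hPU]
    refine SumOf.mul (hU.map (restrictHom I p) (Q := fun t => ∃ (A : Finset (Fin k))
      (a c : (Fin k → V) → ZMod 2), i ∈ A ∧ A ⊆ I ∧ A ∈ 𝓔 ∧ MultilinearOn k A a ∧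
      MultilinearOn k (I \ A) c ∧ t = a * c) fun t ht => ht.restrict hI hi hlow p) hd ?_
    rintro _ _ ⟨A, a, c, hiA, hAI, hA, ha, hc, rfl⟩ ⟨B, b, d, hjB, hBI, hB, hb, hd, rfl⟩
    have hdisj : Disjoint (I \ A) (I ∪ B)ᶜ :=
      disjoint_compl_right.mono_left (sdiff_subset.trans subset_union_left)
    refine ⟨A, B, a, b, c * d, hiA, hjB, (hBI.mono_right hAI).symm, hA, hB, ha, hb, ?_, by ring⟩
    convert hc.mul hd hdisj using 1
    ext x
    have h1 := fun h : x ∈ B => disjoint_left.1 hBI h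
    have h2 := fun h : x ∈ A => hAI h
    simp; tauto
  · rintro _ ⟨B, b, c, -, hBI, -, hb, hc, rfl⟩ x y hxy
    simp only [Pi.mul_apply]
    rw [hb.1 x y fun l hl => hxy l (disjoint_left.1 hBI hl),
      hc.1 x y fun l hl => hxy l fun h => mem_compl.1 hl (mem_union_left _ h)]
  · refine hP.imp ?_
    rintro _ ⟨A, B, a, b, c, -, hjB, hAB, hA, hB, ha, hb, hc, rfl⟩
    obtain rfl := mem_singleton.1 hA
    exact ⟨a, b * c, ha.1, ⟨B, b, c, hjB, hAB.symm, hB, hb, hc, rfl⟩, mul_assoc _ _ _⟩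

theorem sumOf_diag_of_split (hij : i ≠ j) (hcompl : ({i, j}ᶜ : Finset (Fin k)).Nonempty) (n : ℕ) :
    ∀ (𝓐 : Finset (Finset (Fin k))), #𝓐 ≤ n → (∀ S ∈ 𝓐, ∀ T ⊆ S, i ∈ T → T ∈ 𝓐) →
      ∀ (m : ℕ) (α : (Fin k → V) → ZMod 2), 4 ≤ m → SumOf (IsSplitTerm i j 𝓐 𝓐) m α →
        swapHom i j α = α → SumOf (IsDiagTerm j) (m ^ 6 ^ n) (diagHom i j α) := by
  induction n with
  | zero =>
    intro 𝓐 hcard _ m α _ hα _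
    obtain rfl : 𝓐 = ∅ := card_eq_zero.1 (by omega)
    have : α = 0 := hα.induction_closed (Q := (· = 0)) rfl (by simp +contextual) <| by
      rintro t ⟨A, B, a, b, c, -, -, -, hA, -⟩
      simp at hA
    rw [this, map_zero]
    exact .zero _
  | succ n ih =>
    intro 𝓐 hcard hlow m α hm hα hsymm
    by_cases h𝓐 : ∃ S ∈ 𝓐, i ∈ S ∧ S ≠ {i}
    · obtain ⟨S, hS, hiS, hSi⟩ := h𝓐
      obtain ⟨I, hSI, hI⟩ := 𝓐.exists_le_maximal hS
      have hSI : S ⊆ I := hSI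
      have hIi : I ≠ {i} := by
        rintro rfl
        exact hSi (hSI.antisymm (singleton_subset_iff.2 hiS))
      obtain ⟨α', hsymm', hdiag, hα'⟩ :=
        exists_eliminate_block hij hI (hSI hiS) hIi hlow hα hsymm
      have hle : 16 * m ^ 3 + m ≤ m ^ 6 := by
        have h1 : 4 ^ 3 ≤ m ^ 3 := Nat.pow_le_pow_left hm 3
        have h2 : m ≤ m ^ 3 := Nat.le_self_pow (by norm_num) m
        calc 16 * m ^ 3 + m ≤ m ^ 3 * m ^ 3 := by nlinarith
          _ = m ^ 6 := by ring
      rw [← hdiag, pow_succ', pow_mul]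
      refine ih (𝓐.erase I) ?_ ?_ (m ^ 6) α' ?_ (hα'.mono hle) hsymm'
      · rw [card_erase_of_mem hI.prop]; omega
      · intro S hS T hTS hiT
        obtain ⟨hSI, hS⟩ := mem_erase.1 hS
        refine mem_erase.2 ⟨?_, hlow S hS T hTS hiT⟩
        intro hTI
        exact hSI (hI.eq_of_le hS (hTI ▸ hTS)).symm
      · exact hm.trans (Nat.le_self_pow (by norm_num) m)
    · push Not at h𝓐
      have hcontr := SumOf.contract (I := {i, j}) (m := m) (F := α)
        (Γ := MultilinearOn k ({i, j}ᶜ : Finset (Fin k))) ?_ ?_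
      · refine (hcontr.map (diagHom i j) (Q := IsDiagTerm j) ?_).mono
          (Nat.le_self_pow (by positivity) m)
        rintro _ ⟨p, c, hc, rfl⟩
        refine isDiagTerm_diagHom hij (J := {i, j}ᶜ) (by simp) (by simp) hcompl ?_
          (swapHom_restrictHom (by simp) (by simp) p hsymm)
          (hc.induction_closed .zero (fun _ _ => .add) fun _ => id)
        have := (hα.induction_closed .zero (fun _ _ => .add) fun _ ht =>
          ht.multilinear).piecewise {i, j} p
        rw [univ_inter] at this
        rwa [compl_compl]
      · exact fun c hc x y hxy => hc.1 x y fun l hl => hxy l (mem_compl.1 hl)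
      · refine hα.imp ?_
        rintro _ ⟨A, B, a, b, c, hi, hj, hAB, hA, hB, ha, hb, hc, rfl⟩
        obtain rfl := h𝓐 A hA hi
        have hB' := h𝓐 _ hB (mem_image.2 ⟨j, hj, by simp⟩)
        obtain rfl : B = {j} := by
          have := congrArg (image (Equiv.swap i j)) hB'
          simpa [image_image, ← Equiv.coe_trans] using this
        exact ⟨a * b, c, (ha.mul hb hAB).1, hc, rfl⟩

/-- The step of the elimination of joint terms: the minimal set `J` is removed. -/
theorem exists_eliminate_joint (hij : i ≠ j) {𝓙 𝓐 : Finset (Finset (Fin k))}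
    {J : Finset (Fin k)} (hJ : Minimal (· ∈ 𝓙) J) (hJne : J.Nonempty) (hi : i ∉ J) (hj : j ∉ J)
    (hup : ∀ S ∈ 𝓙, ∀ T, S ⊆ T → i ∉ T → j ∉ T → T ∈ 𝓙) (h𝓐 : ∀ S, i ∈ S → S ∈ 𝓐)
    {m : ℕ} {H P : (Fin k → V) → ZMod 2} (hH : SumOf (IsJointTerm i j 𝓙) m H)
    (hP : SumOf (IsSplitTerm i j 𝓐 𝓐) m P) (hsymm : swapHom i j (H + P) = H + P) :
    ∃ H' P' : (Fin k → V) → ZMod 2, swapHom i j (H' + P') = H' + P' ∧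
      (∃ G, diagHom i j (H + P) = G + diagHom i j (H' + P') ∧ SumOf (IsDiagTerm j) m G) ∧
      SumOf (IsJointTerm i j (𝓙.erase J)) (2 * m ^ 2 + m) H' ∧
      SumOf (IsSplitTerm i j 𝓐 𝓐) (2 * m ^ 2 + m) P' := by
  have hα : MultilinearOn k univ (H + P) := by
    refine (hH.induction_closed (Q := MultilinearOn k univ) .zero (fun _ _ => .add) ?_).add
      (hP.induction_closed .zero (fun _ _ => .add) fun _ ht => ht.multilinear)
    rintro _ ⟨S, q, c, -, -, -, -, hq, hc, rfl⟩
    have := hq.mul hc disjoint_compl_left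
    rwa [union_comm, union_compl] at this
  obtain ⟨H₁, H₂, rfl, hH₁, hH₂⟩ := hH.split (m₁ := 1) (m₂ := 1)
      (Q := IsJointTerm i j {J}) (R := IsJointTerm i j (𝓙.erase J)) fun t ht => by
    obtain ⟨S, q, c, hiS, hjS, hS, hSJ, h⟩ := ht
    by_cases hSJ' : S = J
    · exact ⟨t, 0, by simp, .single ⟨S, q, c, hiS, hjS, hS, by simp [hSJ'], h⟩, .zero _⟩
    · exact ⟨0, t, by simp, .zero _, .single ⟨S, q, c, hiS, hjS, hS,
        mem_erase.2 ⟨hSJ', hSJ⟩, h⟩⟩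
  rw [mul_one] at hH₁ hH₂
  have hcontr := SumOf.contract (I := Jᶜ) (F := H₁) (m := m) (Γ := MultilinearOn k J)
    (fun c hc x y hxy => hc.1 x y fun l hl => hxy l (by simpa using hl)) <| hH₁.imp <| by
      rintro _ ⟨S, q, c, -, -, -, hS, hq, hc, rfl⟩
      obtain rfl := mem_singleton.1 hS
      exact ⟨q, c, hq.1, hc, rfl⟩
  obtain ⟨G, U, rfl, hG, hU⟩ := hcontr.split (m₁ := 1) (m₂ := m + m)
      (Q := fun t => swapHom i j t = t ∧ IsDiagTerm j (diagHom i j t))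
      (R := fun t => IsJointTerm i j (𝓙.erase J) t ∨ IsSplitTerm i j 𝓐 𝓐 t) <| by
    rintro _ ⟨p, c, hc, rfl⟩
    replace hc : MultilinearOn k J c := hc.induction_closed .zero (fun _ _ => .add) fun _ => id
    have hsymm' := swapHom_restrictHom (mem_compl.2 hi) (mem_compl.2 hj) p hsymm
    have hαp := hα.piecewise Jᶜ p
    rw [univ_inter] at hαp
    refine ⟨restrictHom Jᶜ p (H₁ + H₂ + P) * c, restrictHom Jᶜ p H₂ * c + restrictHom Jᶜ p P * c,
      ?_, .single ⟨?_, isDiagTerm_diagHom hij hi hj hJne hαp hsymm' hc⟩, .append ?_ ?_⟩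
    · simp only [map_add]
      linear_combination -c * add_self_form (restrictHom Jᶜ p H₂) -
        c * add_self_form (restrictHom Jᶜ p P)
    · have hcs : swapHom i j c = c := funext fun z => hc.1 _ _ fun l hl => by
        have hli : l ≠ i := by rintro rfl; exact hi hl
        have hlj : l ≠ j := by rintro rfl; exact hj hl
        simp [Equiv.swap_apply_of_ne_of_ne hli hlj]
      calc _ = swapHom i j (restrictHom Jᶜ p (H₁ + H₂ + P)) * swapHom i j c := rfl
        _ = _ := by rw [hsymm', hcs]
    · refine (hH₂.map (restrictHom Jᶜ p)
        (Q := fun t => IsJointTerm i j (𝓙.erase J) (t * c)) ?_).map (AddMonoidHom.mulRight c)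
        fun t ht => .inl ht
      rintro _ ⟨S, q, d, hiS, hjS, hS, hSJ, hq, hd, rfl⟩
      obtain ⟨hSJ, hS𝓙⟩ := mem_erase.1 hSJ
      have hiU : i ∉ S ∪ J := by simp [hiS, hi]
      have hjU : j ∉ S ∪ J := by simp [hjS, hj]
      refine ⟨S ∪ J, restrictHom Jᶜ p q, restrictHom Jᶜ p d * c, hiU, hjU,
        hS.mono subset_union_left, mem_erase.2 ⟨fun h => hSJ ?_, ?_⟩, ?_, ?_, ?_⟩
      · exact hJ.eq_of_le hS𝓙 (union_eq_right.1 h)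
      · exact hup S hS𝓙 _ subset_union_left hiU hjU
      · rw [compl_union]
        exact hq.piecewise Jᶜ p
      · rw [← sdiff_union_self_eq_union, sdiff_eq_inter_compl]
        exact (hd.piecewise Jᶜ p).mul hc (disjoint_compl_left.mono_left inter_subset_right)
      · rw [← mul_assoc]; rfl
    · refine (hP.map (restrictHom Jᶜ p)
        (Q := fun t => IsSplitTerm i j 𝓐 𝓐 (t * c)) ?_).map (AddMonoidHom.mulRight c)
        fun t ht => .inr ht
      rintro _ ⟨A, B, a, b, d, hiA, hjB, hAB, -, -, ha, hb, hd, rfl⟩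
      have hiA' : i ∈ A ∩ Jᶜ := by simp [hiA, hi]
      have hjB' : j ∈ B ∩ Jᶜ := by simp [hjB, hj]
      refine ⟨A ∩ Jᶜ, B ∩ Jᶜ, restrictHom Jᶜ p a, restrictHom Jᶜ p b, restrictHom Jᶜ p d * c,
        hiA', hjB', hAB.mono inter_subset_left inter_subset_left, h𝓐 _ hiA',
        h𝓐 _ (mem_image.2 ⟨j, hjB', by simp⟩), ha.piecewise Jᶜ p, hb.piecewise Jᶜ p, ?_, ?_⟩
      · have hset : (A ∩ Jᶜ ∪ B ∩ Jᶜ)ᶜ = (A ∪ B)ᶜ ∩ Jᶜ ∪ J := by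
          ext x; simp; tauto
        rw [hset]
        exact (hd.piecewise Jᶜ p).mul hc (disjoint_compl_left.mono_left inter_subset_right)
      · rw [← mul_assoc]; rfl
  obtain ⟨U₁, U₂, rfl, hU₁, hU₂⟩ := hU.split (m₁ := 1) (m₂ := 1)
      (Q := IsJointTerm i j (𝓙.erase J)) (R := IsSplitTerm i j 𝓐 𝓐) fun t ht => by
    rcases ht with ht | ht
    · exact ⟨t, 0, by simp, .single ht, .zero _⟩
    · exact ⟨0, t, by simp, .zero _, .single ht⟩
  have heq : G + (U₁ + U₂) + H₂ + P = G + (U₁ + H₂ + (U₂ + P)) := by abel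
  refine ⟨U₁ + H₂, U₂ + P, ?_, ⟨diagHom i j G, ?_, ?_⟩, ?_, ?_⟩
  · have hGs : swapHom i j G = G := hG.induction_closed (Q := fun t => swapHom i j t = t)
      (map_zero _) (fun a b ha hb => by rw [map_add, ha, hb]) fun t ht => ht.1
    rw [heq, map_add, hGs] at hsymm
    exact add_left_cancel hsymm
  · rw [heq, map_add]
  · exact (hG.map _ fun t ht => ht.2).mono (by omega)
  · exact (hU₁.append hH₂).mono (by ring_nf; omega)
  · exact (hU₂.append hP).mono (by ring_nf; omega)

theorem sumOf_diag_of_joint (hij : i ≠ j) (hcompl : ({i, j}ᶜ : Finset (Fin k)).Nonempty) (n : ℕ) :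
    ∀ (𝓙 : Finset (Finset (Fin k))), #𝓙 ≤ n →
      (∀ S ∈ 𝓙, S.Nonempty ∧ i ∉ S ∧ j ∉ S) →
      (∀ S ∈ 𝓙, ∀ T, S ⊆ T → i ∉ T → j ∉ T → T ∈ 𝓙) →
      ∀ (m : ℕ) (H P : (Fin k → V) → ZMod 2), 4 ≤ m → SumOf (IsJointTerm i j 𝓙) m H →
        SumOf (IsSplitTerm i j univ univ) m P → swapHom i j (H + P) = H + P →
        SumOf (IsDiagTerm j) (m ^ (6 ^ Fintype.card (Finset (Fin k)) * 5 ^ n))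
          (diagHom i j (H + P)) := by
  induction n with
  | zero =>
    intro 𝓙 hcard _ _ m H P hm hH hP hsymm
    obtain rfl : 𝓙 = ∅ := card_eq_zero.1 (by omega)
    have hH0 : H = 0 := hH.induction_closed (Q := (· = 0)) rfl (by simp +contextual) <| by
      rintro t ⟨S, q, c, -, -, -, hS, -⟩
      simp at hS
    rw [hH0, zero_add] at hsymm ⊢
    rw [pow_zero, mul_one]
    exact sumOf_diag_of_split hij hcompl _ univ (by simp) (by simp) m P hm hP hsymm
  | succ n ih =>
    intro 𝓙 hcard h𝓙 hup m H P hm hH hP hsymm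
    rcases 𝓙.eq_empty_or_nonempty with rfl | ⟨S, hS⟩
    · exact (ih ∅ (by simp) h𝓙 hup m H P hm hH hP hsymm).mono <|
        Nat.pow_le_pow_right (by omega) <| Nat.mul_le_mul_left _ <|
          Nat.pow_le_pow_right (by norm_num) n.le_succ
    obtain ⟨J, -, hJ⟩ := 𝓙.exists_le_minimal hS
    obtain ⟨hJne, hi, hj⟩ := h𝓙 J hJ.prop
    obtain ⟨H', P', hsymm', ⟨G, hG, hGd⟩, hH', hP'⟩ :=
      exists_eliminate_joint hij hJ hJne hi hj hup (fun S _ => mem_univ S) hH hP hsymm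
    have hle : 2 * m ^ 2 + m ≤ m ^ 4 := by
      have h1 : 4 ^ 2 ≤ m ^ 2 := Nat.pow_le_pow_left hm 2
      have h2 : m ≤ m ^ 2 := Nat.le_self_pow (by norm_num) m
      calc 2 * m ^ 2 + m ≤ m ^ 2 * m ^ 2 := by nlinarith
        _ = m ^ 4 := by ring
    have hrec := ih (𝓙.erase J) (by rw [card_erase_of_mem hJ.prop]; omega)
      (fun S hS => h𝓙 S (mem_of_mem_erase hS)) (fun S hS T hST hiT hjT => by
        obtain ⟨hSJ, hS⟩ := mem_erase.1 hS
        refine mem_erase.2 ⟨fun hTJ => hSJ ?_, hup S hS T hST hiT hjT⟩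
        exact hJ.eq_of_le hS (hTJ ▸ hST))
      (m ^ 4) H' P' (hm.trans (Nat.le_self_pow (by norm_num) m)) (hH'.mono hle) (hP'.mono hle)
      hsymm'
    rw [hG]
    refine (hGd.append hrec).mono ?_
    set x := 6 ^ Fintype.card (Finset (Fin k)) * 5 ^ n with hx
    have hx1 : 1 ≤ x := Nat.one_le_iff_ne_zero.2 (by positivity)
    have h1 : m ≤ m ^ (4 * x) := Nat.le_self_pow (by omega) m
    calc m + (m ^ 4) ^ x = m + m ^ (4 * x) := by rw [← pow_mul]
      _ ≤ m ^ (4 * x) * m := by nlinarith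
      _ = m ^ (4 * x + 1) := (pow_succ _ _).symm
      _ ≤ m ^ (5 * x) := Nat.pow_le_pow_right (by omega) (by omega)
      _ = _ := by rw [hx, pow_succ]; ring_nf

/-- The partition rank of the diagonal form is polynomially bounded. -/
theorem PrankDecompOn.diag (hij : i ≠ j) (hcompl : ({i, j}ᶜ : Finset (Fin k)).Nonempty) {m : ℕ}
    {α : (Fin k → V) → ZMod 2} (hα : PrankDecompOn k univ m α) (hsymm : swapHom i j α = α) :
    ∃ m' ≤ (m + 4) ^ (6 ^ Fintype.card (Finset (Fin k)) * 5 ^ Fintype.card (Finset (Fin k))),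
      PrankDecompOn k (univ.erase j) m' (diagHom i j α) := by
  obtain ⟨I, β, γ, -, hIne, hIuniv, hβ, hγ, hαβγ⟩ := hα
  have hsum : SumOf (fun t => ∃ (I : Finset (Fin k)) (β γ : (Fin k → V) → ZMod 2), I.Nonempty ∧
      Iᶜ.Nonempty ∧ MultilinearOn k I β ∧ MultilinearOn k Iᶜ γ ∧ t = β * γ) (m * 1) α := by
    have : α = ∑ l, β l * γ l := funext fun x => by simp [hαβγ]
    rw [this]
    refine SumOf.sum fun l => .single ⟨I l, β l, γ l, nonempty_iff_ne_empty.2 (hIne l), ?_,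
      hβ l, by simpa [compl_eq_univ_sdiff] using hγ l, rfl⟩
    rw [nonempty_iff_ne_empty, Ne, compl_eq_empty_iff]
    exact hIuniv l
  set 𝓙 : Finset (Finset (Fin k)) := univ.filter fun S => S.Nonempty ∧ i ∉ S ∧ j ∉ S with h𝓙
  have hsplit : ∀ (I : Finset (Fin k)) (β γ : (Fin k → V) → ZMod 2), i ∈ I → j ∉ I →
      MultilinearOn k I β → MultilinearOn k Iᶜ γ → IsSplitTerm i j univ univ (β * γ) :=
    fun I β γ hi hj hβ hγ => ⟨I, Iᶜ, β, γ, 1, hi, mem_compl.2 hj, disjoint_compl_right,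
      mem_univ _, mem_univ _, hβ, hγ, by simpa using MultilinearOn.one, (mul_one _).symm⟩
  obtain ⟨H, P, rfl, hH, hP⟩ := hsum.split (m₁ := 1) (m₂ := 1) (Q := IsJointTerm i j 𝓙)
      (R := IsSplitTerm i j univ univ) <| by
    rintro _ ⟨I, β, γ, hI, hI', hβ, hγ, rfl⟩
    by_cases hi : i ∈ I <;> by_cases hj : j ∈ I
    · exact ⟨_, 0, (add_zero _).symm, .single ⟨Iᶜ, β, γ, by simpa using hi, by simpa using hj, hI',
        by simp [h𝓙, hi, hj, hI'], by simpa using hβ, hγ, rfl⟩, .zero _⟩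
    · exact ⟨0, _, (zero_add _).symm, .zero _, .single (hsplit I β γ hi hj hβ hγ)⟩
    · rw [mul_comm]
      exact ⟨0, _, (zero_add _).symm, .zero _, .single (hsplit Iᶜ γ β (by simpa using hi)
        (by simpa using hj) hγ (by simpa using hβ))⟩
    · rw [mul_comm]
      exact ⟨_, 0, (add_zero _).symm, .single ⟨I, γ, β, hi, hj, hI,
        by simp [h𝓙, hi, hj, hI], hγ, hβ, rfl⟩, .zero _⟩
  obtain ⟨m', hm', t, ht, hsumt⟩ := (sumOf_diag_of_joint hij hcompl _ 𝓙 (card_le_univ _)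
    (by simp [h𝓙]) (by
      intro S hS T hST hi hj
      simp only [h𝓙, mem_filter, mem_univ, true_and] at hS ⊢
      exact ⟨hS.1.mono hST, hi, hj⟩)
    (m + 4) H P (by omega) (hH.mono (by omega)) (hP.mono (by omega)) hsymm).exists_sum
  choose I' β' γ' h1 h2 h3 h4 h5 h6 using ht
  exact ⟨m', hm', I', β', γ', h1, h2, h3, h4, h5, fun x => by rw [hsumt]; simp [h6]⟩

end Decomposition

section Rank

variable {V : Type*} [AddCommGroup V] [Module (ZMod 2) V] {k : ℕ}

theorem prankOn_le {S : Finset (Fin k)} {m : ℕ} {f : (Fin k → V) → ZMod 2}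
    (h : PrankDecompOn k S m f) : prankOn k S f ≤ m :=
  Nat.sInf_le h

theorem prankOn_eq_zero {S : Finset (Fin k)} (hS : #S ≤ 1) (f : (Fin k → V) → ZMod 2) :
    prankOn k S f = 0 := by
  refine Nat.sInf_eq_zero.2 ?_
  rcases Set.eq_empty_or_nonempty {m | PrankDecompOn k S m f} with h | ⟨m, h⟩
  · exact .inr h
  refine .inl ?_
  cases m with
  | zero => exact h
  | succ m =>
    obtain ⟨I, -, -, hsub, hne, hne', -⟩ := h
    have := card_pos.2 (nonempty_iff_ne_empty.2 (hne 0))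
    have := card_lt_card ((hsub 0).ssubset_of_ne (hne' 0))
    omega

/-- Partition rank decompositions are transported along injective relabellings of variables. -/
theorem PrankDecompOn.comp {l m : ℕ} {S : Finset (Fin k)} {f : (Fin k → V) → ZMod 2}
    (h : PrankDecompOn k S m f) (ψ : Fin k → Fin l) (hψ : Set.InjOn ψ S) :
    PrankDecompOn l (S.image ψ) m fun y => f fun i => y (ψ i) := by
  obtain ⟨I, β, γ, hsub, hne, hne', hβ, hγ, hf⟩ := h
  refine ⟨fun s => (I s).image ψ, fun s y => β s fun i => y (ψ i),
    fun s y => γ s fun i => y (ψ i), fun s => image_subset_image (hsub s), fun s => ?_,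
    fun s h => hne' s ?_, fun s => (hβ s).comp ψ (hψ.mono (hsub s)), fun s => ?_, fun y => hf _⟩
  · simpa using hne s
  · refine eq_of_subset_of_card_le (hsub s) ?_
    rw [← card_image_of_injOn hψ, ← h]
    exact card_image_le
  · rw [← image_sdiff_of_injOn hψ (hsub s)]
    exact (hγ s).comp ψ (hψ.mono (by simp))

theorem MultilinearOn.update_sum {S : Finset (Fin k)} {f : (Fin k → V) → ZMod 2}
    (hf : MultilinearOn k S f) {i : Fin k} (hi : i ∈ S) {ι : Type*} (s : Finset ι) (v : ι → V)
    (x : Fin k → V) :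
    f (Function.update x i (∑ a ∈ s, v a)) = ∑ a ∈ s, f (Function.update x i (v a)) :=
  map_sum (AddMonoidHom.mk' (fun u => f (Function.update x i u)) (hf.2 i hi x)) v s

theorem MultilinearOn.update_smul {S : Finset (Fin k)} {f : (Fin k → V) → ZMod 2}
    (hf : MultilinearOn k S f) {i : Fin k} (hi : i ∈ S) (c : ZMod 2) (v : V) (x : Fin k → V) :
    f (Function.update x i (c • v)) = c * f (Function.update x i v) := by
  have h0 : f (Function.update x i 0) = 0 := by simpa using hf.update_sum hi ∅ (fun _ : V => 0) x
  rcases (by decide : ∀ c : ZMod 2, c = 0 ∨ c = 1) c with rfl | rfl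
  · simp [h0]
  · simp

theorem MultilinearOn.exists_prankDecompOn {n : ℕ} {f : (Fin k → Fin n → ZMod 2) → ZMod 2}
    (hf : MultilinearOn k univ f) (hk : 2 ≤ k) : PrankDecompOn k univ n f := by
  have : NeZero k := ⟨by omega⟩
  have hcard : #({0} : Finset (Fin k)) ≠ #(univ : Finset (Fin k)) := by
    rw [card_singleton, card_univ, Fintype.card_fin]; omega
  refine ⟨fun _ => {0}, fun a z => z 0 a, fun a z => f (Function.update z 0 (Pi.single a 1)),
    fun _ => subset_univ _, by simp, fun _ h => hcard (congrArg card h),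
    fun a => ⟨fun x y h => by simp [h], by simp⟩, fun a => ⟨fun x y h => ?_, ?_⟩, fun x => ?_⟩
  · refine hf.1 _ _ fun i _ => ?_
    by_cases hi : i = 0
    · simp [hi]
    · simp [hi, h i (by simpa using hi)]
  · intro i hi x u v
    have hi : i ≠ 0 := by simpa using hi
    simp only [Function.update_comm hi, hf.2 i (mem_univ i)]
  · conv_lhs => rw [← Function.update_eq_self 0 x, pi_eq_sum_univ' (x 0)]
    rw [hf.update_sum (mem_univ 0)]
    simp only [hf.update_smul (mem_univ 0)]

end Rank

/-- **Lemma 21 (partition rank of the doubled form).**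
For every `k` there are `C, D ≥ 1` such that: if `α : G^k → 𝔽₂` is multilinear,
symmetric in its first two variables, and has partition rank at most `r`, then the
multilinear form `α^{×2}(d, x₃, …, x_k) = α(d, d, x₃, …, x_k)` has partition rank at
most `C·r^D`. -/
theorem statement15 (k : ℕ) (hk : 2 ≤ k) :
    ∃ C D : ℝ, 1 ≤ C ∧ 1 ≤ D ∧
      ∀ (n r : ℕ) (α : (Fin k → (Fin n → ZMod 2)) → ZMod 2),
        IsMultilinear k α → SymmetricInFirst k 2 α → prank k α ≤ r →
        (prank (k - 1) (fun y : Fin (k - 1) → Fin n → ZMod 2 =>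
            α fun i => y ⟨(i : ℕ) - 1, by have := i.isLt; omega⟩) : ℝ) ≤
          C * (r : ℝ) ^ D := by
  set E := 6 ^ Fintype.card (Finset (Fin k)) * 5 ^ Fintype.card (Finset (Fin k))
  have hE1 : 1 ≤ E := Nat.one_le_iff_ne_zero.2 (by positivity)
  refine ⟨5 ^ E, E, one_le_pow₀ (by norm_num), by exact_mod_cast hE1, ?_⟩
  intro n r α hα hsymm hr
  rw [Real.rpow_natCast, ← mul_pow]
  set f : (Fin (k - 1) → Fin n → ZMod 2) → ZMod 2 :=
    fun y => α fun i => y ⟨(i : ℕ) - 1, by have := i.isLt; omega⟩ with hf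
  suffices h : prank (k - 1) f ≤ (5 * r) ^ E by exact_mod_cast h
  rcases hk.eq_or_lt with rfl | hk3
  · exact (prankOn_eq_zero (by simp) f).trans_le (Nat.zero_le _)
  have hdec : PrankDecompOn k univ (prank k α) α :=
    Nat.sInf_mem (s := {m | PrankDecompOn k univ m α}) ⟨n, hα.exists_prankDecompOn hk⟩
  rcases r.eq_zero_or_pos with rfl | hr0
  · obtain ⟨I, β, γ, -, -, -, -, -, hsum⟩ := Nat.le_zero.1 hr ▸ hdec
    refine (prankOn_le (m := 0) ⟨Fin.elim0, Fin.elim0, Fin.elim0, fun i => i.elim0,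
      fun i => i.elim0, fun i => i.elim0, fun i => i.elim0, fun i => i.elim0,
      fun y => ?_⟩).trans (Nat.zero_le _)
    simp [hf, hsum]
  let i : Fin k := ⟨0, by omega⟩
  let j : Fin k := ⟨1, by omega⟩
  have hij : i ≠ j := by simp [i, j]
  have hcompl : ({i, j}ᶜ : Finset (Fin k)).Nonempty :=
    ⟨⟨2, hk3⟩, by simp [i, j]⟩
  obtain ⟨m, hm, hdiag⟩ := hdec.diag hij hcompl (hsymm i j (by simp [i]) (by simp [j]))
  let ψ : Fin k → Fin (k - 1) := fun l => ⟨(l : ℕ) - 1, by have := l.isLt; omega⟩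
  have hψ : Set.InjOn ψ (univ.erase j : Finset (Fin k)) := by
    intro a ha b hb hab
    have ha : (a : ℕ) ≠ 1 := fun h => (mem_erase.1 ha).1 (Fin.ext h)
    have hb : (b : ℕ) ≠ 1 := fun h => (mem_erase.1 hb).1 (Fin.ext h)
    have hab : (a : ℕ) - 1 = b - 1 := congrArg Fin.val hab
    exact Fin.ext (by omega)
  have himage : (univ.erase j).image ψ = univ := by
    refine eq_univ_of_card _ ?_
    rw [card_image_of_injOn hψ, card_erase_of_mem (mem_univ j), card_univ, Fintype.card_fin,
      Fintype.card_fin]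
  have hf' : f = fun y => diagHom i j α fun l => y (ψ l) := by
    funext y
    refine congrArg α (funext fun l => ?_)
    by_cases hl : l = j
    · subst hl; simp [ψ, i, j]
    · simp [hl, ψ]
  have hdec' := hdiag.comp ψ hψ
  rw [himage, ← hf'] at hdec'
  exact (prankOn_le hdec').trans <| hm.trans <| Nat.pow_le_pow_left (by omega) E
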